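/- For the SAUIS model, the region Ω = {(a,u,i) ∈ ℝ³ : a ≥ 0, u ≥ 0, i ≥ 0, a + u + i ≤ 1} is positively invariant: if a, u, i : ℝ → ℝ are differentiable functions satisfying a'(t) = α_i·s·i + α_a·s·a + p·δ·i − β_a·a·i − δ_a·a, u'(t) = δ_a·a + α_u·s·a + q·δ·i − β_u·u·i − δ_u·u, and i'(t) = (β·s + β_a·a + β_u·u − δ)·i, with s = 1 − a(t) − u(t) − i(t), for all t ≥ 0, and (a(0), u(0), i(0)) ∈ Ω, then (a(t), u(t), i(t)) ∈ Ω for all t ≥ 0. -/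

import Mathlib

open Set Filter

lemma gron_aux (f f' : ℝ → ℝ) (K T : ℝ)
    (hd : ∀ t, 0 ≤ t → HasDerivAt f (f' t) t)
    (hb : ∀ t, 0 ≤ t → t ≤ T → f' t ≤ K * f t) (h0 : f 0 ≤ 0) (hT : 0 ≤ T) : f T ≤ 0 := by
  have hg : ∀ t, 0 ≤ t → HasDerivAt (fun t => f t * Real.exp (-K * t))
      (f' t * Real.exp (-K * t) + f t * (Real.exp (-K * t) * (-K * 1))) t := fun t ht =>
    (hd t ht).mul (((hasDerivAt_id t).const_mul (-K)).exp)
  have hanti : AntitoneOn (fun t => f t * Real.exp (-K * t)) (Icc 0 T) := by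
    apply antitoneOn_of_deriv_nonpos (convex_Icc 0 T)
    · exact fun t ht => (hg t ht.1).continuousAt.continuousWithinAt
    · intro t ht
      rw [interior_Icc] at ht
      exact (hg t ht.1.le).differentiableAt.differentiableWithinAt
    · intro t ht
      rw [interior_Icc] at ht
      rw [(hg t ht.1.le).deriv]
      have := hb t ht.1.le ht.2.le
      have he := Real.exp_pos (-K * t)
      nlinarith
  have h := hanti (left_mem_Icc.2 hT) (right_mem_Icc.2 hT) hT
  have he := Real.exp_pos (-K * T)
  simp only [mul_zero, Real.exp_zero, mul_one] at h
  by_contra hc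
  push Not at hc
  have := mul_pos hc he
  linarith

lemma minsq_deriv (x : ℝ) : HasDerivAt (fun y : ℝ => (min y 0) ^ 2) (2 * min x 0) x := by
  rcases lt_trichotomy x 0 with h | h | h
  · have h1 : HasDerivAt (fun y : ℝ => y ^ 2) (2 * min x 0) x := by
      simpa [min_eq_left h.le] using hasDerivAt_pow 2 x
    apply h1.congr_of_eventuallyEq
    filter_upwards [Iio_mem_nhds h] with y hy
    rw [min_eq_left (le_of_lt hy)]
  · subst h
    have : (fun y : ℝ => (min y 0) ^ 2) =O[nhds 0] fun y => ‖y - 0‖ ^ 2 := by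
      apply Asymptotics.IsBigO.of_bound 1
      filter_upwards with y
      simp only [sub_zero, norm_pow, one_mul, Real.norm_eq_abs, sq_abs]
      rcases le_total y 0 with h | h
      · rw [min_eq_left h]
      · rw [min_eq_right h]; nlinarith
    have h2 := (this.hasFDerivAt (𝕜 := ℝ) (by norm_num)).hasDerivAt
    simpa using h2
  · have h1 : HasDerivAt (fun y : ℝ => (0 : ℝ)) (2 * min x 0) x := by
      simpa [min_eq_right h.le] using hasDerivAt_const x (0 : ℝ)
    apply h1.congr_of_eventuallyEq
    filter_upwards [Ioi_mem_nhds h] with y hy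
    rw [min_eq_right (le_of_lt hy)]; norm_num

lemma minsq_comp {f : ℝ → ℝ} {f' t : ℝ} (h : HasDerivAt f f' t) :
    HasDerivAt (fun t => (min (f t) 0) ^ 2) (2 * min (f t) 0 * f') t :=
  (minsq_deriv (f t)).comp t h

lemma min_decomp (x M : ℝ) (hx : |x| ≤ M) :
    ∃ y, x = min x 0 + y ∧ 0 ≤ y ∧ y ≤ M ∧ min x 0 ≤ 0 ∧ min x 0 * y = 0 := by
  have := abs_le.1 hx
  rcases le_total x 0 with h | h
  · exact ⟨0, by simp [h], le_rfl, by linarith, by simp, by simp⟩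
  · exact ⟨x, by simp [h], h, by linarith, by simp, by simp [h]⟩

lemma key_ineq (αi αa αu δ δa δu β βa βu p q M a u i s : ℝ)
    (hαi : 0 < αi) (hαa : 0 < αa) (hαu : 0 < αu)
    (hδ : 0 < δ) (hδa : 0 < δa) (hδu : 0 < δu)
    (hβa0 : 0 ≤ βa) (hβ : 0 ≤ β) (hβu0 : 0 ≤ βu)
    (hp : 0 ≤ p) (hq : 0 ≤ q) (hpq : p + q ≤ 1)
    (ha : |a| ≤ M) (hu : |u| ≤ M) (hi : |i| ≤ M) (hs : |s| ≤ M) (hi0 : 0 ≤ i) :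
    2 * min a 0 * (αi * s * i + αa * s * a + p * δ * i - βa * a * i - δa * a)
    + 2 * min u 0 * (δa * a + αu * s * a + q * δ * i - βu * u * i - δu * u)
    + 2 * min s 0 * (-(s * ((αi + β) * i + (αa + αu) * a)) + (1 - p - q) * δ * i + δu * u)
    ≤ (2 * (αi * M + αa * M + δa + 2 * αu * M + (αa + αu) * M + δu))
      * ((min a 0) ^ 2 + (min u 0) ^ 2 + (min s 0) ^ 2) := by
  obtain ⟨y, e1, y0, yM, A0, Ay⟩ := min_decomp a M ha
  obtain ⟨z, e2, z0, zM, U0, Uz⟩ := min_decomp u M hu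
  obtain ⟨w, e3, w0, wM, S0, Sw⟩ := min_decomp s M hs
  have a1 := abs_le.1 ha
  have s1 := abs_le.1 hs
  have iM := (abs_le.1 hi).2
  generalize min a 0 = A at *
  generalize min u 0 = U at *
  generalize min s 0 = S at *
  have M0 : 0 ≤ M := y0.trans yM
  obtain ⟨V, hV⟩ : ∃ V, V = A ^ 2 + U ^ 2 + S ^ 2 := ⟨_, rfl⟩
  rw [← hV]
  have AS : 0 ≤ A * S := mul_nonneg_of_nonpos_of_nonpos A0 S0
  have AU : 0 ≤ A * U := mul_nonneg_of_nonpos_of_nonpos A0 U0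
  have US : 0 ≤ U * S := mul_nonneg_of_nonpos_of_nonpos U0 S0
  have ASV : A * S ≤ V := by linarith [sq_nonneg (A - S), sq_nonneg U, sq_nonneg A, sq_nonneg S]
  have AUV : A * U ≤ V := by linarith [sq_nonneg (A - U), sq_nonneg U, sq_nonneg A, sq_nonneg S]
  have USV : U * S ≤ V := by linarith [sq_nonneg (U - S), sq_nonneg U, sq_nonneg A, sq_nonneg S]
  have AV : A ^ 2 ≤ V := by linarith [sq_nonneg U, sq_nonneg S]
  have SV : S ^ 2 ≤ V := by linarith [sq_nonneg U, sq_nonneg A]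
  have eA : A * a = A ^ 2 := by rw [e1]; linear_combination Ay
  have eU : U * u = U ^ 2 := by rw [e2]; linear_combination Uz
  have eS : S * s = S ^ 2 := by rw [e3]; linear_combination Sw
  have mulb : ∀ x c : ℝ, 0 ≤ x → x ≤ V → c ≤ M → c * x ≤ M * V := fun x c h1 h2 h3 =>
    (mul_le_mul_of_nonneg_right h3 h1).trans (mul_le_mul_of_nonneg_left h2 M0)
  have t1 : A * s * i ≤ M * V := by
    have h1 : A * s * i = i * (A * S) + A * (w * i) := by rw [e3]; ring
    have h2 := mulb _ i AS ASV iM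
    have h3 := mul_nonpos_of_nonpos_of_nonneg A0 (mul_nonneg w0 hi0)
    linarith
  have t2 : s * A ^ 2 ≤ M * V := mulb _ s (sq_nonneg _) AV s1.2
  have t3 : 0 ≤ i * A ^ 2 := by positivity
  have t4 : i * A ≤ 0 := mul_nonpos_of_nonneg_of_nonpos hi0 A0
  have t5 : i * U ≤ 0 := mul_nonpos_of_nonneg_of_nonpos hi0 U0
  have t6 : i * S ≤ 0 := mul_nonpos_of_nonneg_of_nonpos hi0 S0
  have t7 : U * a ≤ V := by
    have h1 : U * a = A * U + U * y := by rw [e1]; ring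
    have := mul_nonpos_of_nonpos_of_nonneg U0 y0
    linarith
  have t8 : U * s * a ≤ 2 * (M * V) := by
    have h1 : U * s * a = (A * S) * U + y * (U * S) + w * (A * U) + U * (w * y) := by
      rw [e1, e3]; ring
    have h2 := mulb _ y US USV yM
    have h3 := mulb _ w AU AUV wM
    have h4 := mul_nonpos_of_nonpos_of_nonneg U0 (mul_nonneg w0 y0)
    have h5 := mul_nonpos_of_nonneg_of_nonpos AS U0
    linarith
  have t9 : 0 ≤ i * U ^ 2 := by positivity
  have t10 : 0 ≤ i * S ^ 2 := by positivity
  have t11 : -a * S ^ 2 ≤ M * V := mulb _ (-a) (sq_nonneg _) SV (by linarith)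
  have t12 : S * u ≤ V := by
    have h1 : S * u = U * S + S * z := by rw [e2]; ring
    have := mul_nonpos_of_nonpos_of_nonneg S0 z0
    linarith
  have b1 := mul_le_mul_of_nonneg_left t1 hαi.le
  have b2 := mul_le_mul_of_nonneg_left t2 hαa.le
  have b3 := mul_nonneg hβa0 t3
  have b4 := mul_nonpos_of_nonneg_of_nonpos (mul_nonneg hp hδ.le) t4
  have b5 := mul_nonpos_of_nonneg_of_nonpos (mul_nonneg hq hδ.le) t5
  have b6 := mul_nonpos_of_nonneg_of_nonpos (mul_nonneg (by linarith : 0 ≤ 1 - p - q) hδ.le) t6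
  have b7 := mul_le_mul_of_nonneg_left t7 hδa.le
  have b8 := mul_le_mul_of_nonneg_left t8 hαu.le
  have b9 := mul_nonneg hβu0 t9
  have b10 := mul_nonneg (by linarith : 0 ≤ αi + β) t10
  have b11 := mul_le_mul_of_nonneg_left t11 (by linarith : 0 ≤ αa + αu)
  have b12 := mul_le_mul_of_nonneg_left t12 hδu.le
  have b13 := mul_nonneg hδa.le (sq_nonneg A)
  have b14 := mul_nonneg hδu.le (sq_nonneg U)
  have E : A * (αi * s * i + αa * s * a + p * δ * i - βa * a * i - δa * a)
    + U * (δa * a + αu * s * a + q * δ * i - βu * u * i - δu * u)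
    + S * (-(s * ((αi + β) * i + (αa + αu) * a)) + (1 - p - q) * δ * i + δu * u)
    = αi * (A * s * i) + αa * (s * A ^ 2) - βa * (i * A ^ 2) + p * δ * (i * A) + q * δ * (i * U)
      + (1 - p - q) * δ * (i * S) + δa * (U * a) + αu * (U * s * a) - βu * (i * U ^ 2)
      - (αi + β) * (i * S ^ 2) + (αa + αu) * (-a * S ^ 2) + δu * (S * u) - δa * A ^ 2
      - δu * U ^ 2 := by
    linear_combination (αa * s - βa * i - δa) * eA + (-βu * i - δu) * eU
      - ((αi + β) * i + (αa + αu) * a) * eS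
  linarith

theorem sauis_positively_invariant
    (αi αa αu δ δa δu β βa βu p q : ℝ)
    (hαi : 0 < αi) (hαa : 0 < αa) (hαu : 0 < αu)
    (hδ : 0 < δ) (hδa : 0 < δa) (hδu : 0 < δu)
    (hβa0 : 0 ≤ βa) (hβaβ : βa < β) (hβu0 : 0 ≤ βu) (hβuβ : βu < β)
    (hp : 0 ≤ p) (hq : 0 ≤ q) (hpq : p + q ≤ 1)
    (a u i : ℝ → ℝ)
    (hda : ∀ t : ℝ, 0 ≤ t → HasDerivAt a (αi * (1 - a t - u t - i t) * (i t) + αa * (1 - a t - u t - i t) * (a t) + p * δ * (i t) - βa * (a t) * (i t) - δa * (a t)) t)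
    (hdu : ∀ t : ℝ, 0 ≤ t → HasDerivAt u (δa * (a t) + αu * (1 - a t - u t - i t) * (a t) + q * δ * (i t) - βu * (u t) * (i t) - δu * (u t)) t)
    (hdi : ∀ t : ℝ, 0 ≤ t → HasDerivAt i ((β * (1 - a t - u t - i t) + βa * (a t) + βu * (u t) - δ) * (i t)) t)
    (ha0 : 0 ≤ a 0) (hu0 : 0 ≤ u 0) (hi0 : 0 ≤ i 0)
    (hsum0 : a 0 + u 0 + i 0 ≤ 1) :
    ∀ t : ℝ, 0 ≤ t →
      0 ≤ a t ∧ 0 ≤ u t ∧ 0 ≤ i t ∧ a t + u t + i t ≤ 1 := by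
  intro T hT
  have hβ : 0 ≤ β := hβa0.trans hβaβ.le
  obtain ⟨M, hM⟩ : ∃ M, ∀ t ∈ Icc 0 T, 1 + |a t| + |u t| + |i t| ≤ M := by
    have hc : ContinuousOn (fun t => 1 + |a t| + |u t| + |i t|) (Icc 0 T) := by
      have h1 : ContinuousOn a (Icc 0 T) :=
        fun t ht => (hda t ht.1).continuousAt.continuousWithinAt
      have h2 : ContinuousOn u (Icc 0 T) :=
        fun t ht => (hdu t ht.1).continuousAt.continuousWithinAt
      have h3 : ContinuousOn i (Icc 0 T) :=
        fun t ht => (hdi t ht.1).continuousAt.continuousWithinAt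
      exact ((continuousOn_const.add h1.abs).add h2.abs).add h3.abs
    obtain ⟨M, hM⟩ := isCompact_Icc.bddAbove_image hc
    exact ⟨M, fun t ht => hM (mem_image_of_mem _ ht)⟩
  have bnd : ∀ t, 0 ≤ t → t ≤ T → |a t| ≤ M ∧ |u t| ≤ M ∧ |i t| ≤ M ∧
      |1 - a t - u t - i t| ≤ M := by
    intro t h1 h2
    have h := hM t ⟨h1, h2⟩
    have p1 := abs_nonneg (a t)
    have p2 := abs_nonneg (u t)
    have p3 := abs_nonneg (i t)
    refine ⟨by linarith, by linarith, by linarith, abs_le.2 ?_⟩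
    have q1 := abs_le.1 (le_refl |a t|)
    have q2 := abs_le.1 (le_refl |u t|)
    have q3 := abs_le.1 (le_refl |i t|)
    constructor <;> linarith [q1.1, q1.2, q2.1, q2.2, q3.1, q3.2]
  have nn : ∀ x : ℝ, (min x 0) ^ 2 ≤ 0 → 0 ≤ x := by
    intro x hx
    have h := pow_eq_zero_iff (two_ne_zero) |>.1 (le_antisymm hx (sq_nonneg _))
    exact min_eq_right_iff.1 h
  have hi : ∀ t, 0 ≤ t → t ≤ T → 0 ≤ i t := by
    intro t ht htT
    apply nn
    refine gron_aux (fun t => (min (i t) 0) ^ 2) _ (2 * (β * M + βa * M + βu * M)) t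
      (fun t ht => minsq_comp (hdi t ht)) ?_ (by simp [hi0]) ht
    intro r hr hrt
    obtain ⟨b1, b2, b3, b4⟩ := bnd r hr (hrt.trans htT)
    have e : min (i r) 0 * i r = (min (i r) 0) ^ 2 := by
      rcases le_total (i r) 0 with h | h
      · rw [min_eq_left h]; ring
      · rw [min_eq_right h]; ring
    have c1 := mul_le_mul_of_nonneg_left (abs_le.1 b4).2 hβ
    have c2 := mul_le_mul_of_nonneg_left (abs_le.1 b1).2 hβa0
    have c3 := mul_le_mul_of_nonneg_left (abs_le.1 b2).2 hβu0
    have c4 : β * (1 - a r - u r - i r) + βa * a r + βu * u r - δ ≤ β * M + βa * M + βu * M := by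
      linarith
    have c5 := mul_le_mul_of_nonneg_right c4 (sq_nonneg (min (i r) 0))
    have e2 : 2 * min (i r) 0 * ((β * (1 - a r - u r - i r) + βa * a r + βu * u r - δ) * i r)
        = 2 * ((β * (1 - a r - u r - i r) + βa * a r + βu * u r - δ) * (min (i r) 0) ^ 2) := by
      rw [← e]; ring
    rw [e2]
    linarith
  have hds : ∀ t, 0 ≤ t → HasDerivAt (fun t => 1 - a t - u t - i t)
      (-((1 - a t - u t - i t) * ((αi + β) * i t + (αa + αu) * a t)) + (1 - p - q) * δ * i t
        + δu * u t) t := by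
    intro t ht
    refine ((((hda t ht).const_sub 1).sub (hdu t ht)).sub (hdi t ht)).congr_deriv ?_
    ring
  have hV := gron_aux
    (fun t => (min (a t) 0) ^ 2 + (min (u t) 0) ^ 2 + (min (1 - a t - u t - i t) 0) ^ 2) _
    (2 * (αi * M + αa * M + δa + 2 * αu * M + (αa + αu) * M + δu)) T
    (fun t ht => ((minsq_comp (hda t ht)).add (minsq_comp (hdu t ht))).add
      (minsq_comp (hds t ht)))
    (fun t ht htT => by
      obtain ⟨b1, b2, b3, b4⟩ := bnd t ht htT
      exact key_ineq αi αa αu δ δa δu β βa βu p q M (a t) (u t) (i t) _ hαi hαa hαu hδ hδa hδu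
        hβa0 hβ hβu0 hp hq hpq b1 b2 b3 b4 (hi t ht htT))
    (by
      have : 0 ≤ 1 - a 0 - u 0 - i 0 := by linarith
      simp only [min_eq_right ha0, min_eq_right hu0, min_eq_right this]
      norm_num) hT
  have s1 := sq_nonneg (min (a T) 0)
  have s2 := sq_nonneg (min (u T) 0)
  have s3 := sq_nonneg (min (1 - a T - u T - i T) 0)
  have r3 := nn (1 - a T - u T - i T) (by linarith)
  exact ⟨nn _ (by linarith), nn _ (by linarith), hi T hT le_rfl, by linarith⟩
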